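/- Nesting of canonical neighbourhoods: if α^X_{(Y,B)} ∈ 𝒩(X,A) and (U,D) ∈ α^X_{(Y,B)}, then α^X_{(U,D)} ⊆ α^X_{(Y,B)}. -/

import Mathlib

/-- Formulas of conditional logic. -/
inductive Formula : Type
  | atom : ℕ → Formula
  | bot : Formula
  | and : Formula → Formula → Formula
  | or : Formula → Formula → Formula
  | imp : Formula → Formula → Formula
  | cond : Formula → Formula → Formula

namespace Formula

/-- ¬A abbreviates A → ⊥. -/
def neg (A : Formula) : Formula := A.imp Formula.bot

/-- ⊤ abbreviates ⊥ → ⊥. -/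
def top : Formula := Formula.bot.imp Formula.bot

/-- A ↔ B abbreviates (A → B) ∧ (B → A). -/
def biimp (A B : Formula) : Formula := (A.imp B).and (B.imp A)

/-- Boolean evaluation of a formula, where atoms are evaluated via `v` and
conditional subformulas are treated as atoms evaluated via `w`. -/
def beval (v : ℕ → Bool) (w : Formula → Formula → Bool) : Formula → Bool
  | atom p => v p
  | bot => false
  | and A B => beval v w A && beval v w B
  | or A B => beval v w A || beval v w B
  | imp A B => !(beval v w A) || beval v w B
  | cond A B => w A B

/-- Classical propositional tautology (conditional subformulas treated as atoms). -/
def Tautology (F : Formula) : Prop := ∀ v w, beval v w F = true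

end Formula

open Formula

/-- Hilbert-style derivability: classical tautologies, modus ponens,
(RCEA), (RCK), (ID), (R-And), (CM), (OR), plus extra axioms from `Ax`. -/
inductive Deriv (Ax : Set Formula) : Formula → Prop
  | taut {F : Formula} : Tautology F → Deriv Ax F
  | extra {F : Formula} : F ∈ Ax → Deriv Ax F
  | mp {A B : Formula} : Deriv Ax (A.imp B) → Deriv Ax A → Deriv Ax B
  | rcea {A B C : Formula} : Deriv Ax (A.biimp B) →
      Deriv Ax ((A.cond C).biimp (B.cond C))
  | rck {A B C : Formula} : Deriv Ax (A.imp B) → Deriv Ax ((C.cond A).imp (C.cond B))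
  | id {A : Formula} : Deriv Ax (A.cond A)
  | rAnd {A B C : Formula} : Deriv Ax (((A.cond B).and (A.cond C)).imp (A.cond (B.and C)))
  | cm {A B C : Formula} : Deriv Ax (((A.cond B).and (A.cond C)).imp ((A.and B).cond C))
  | or {A B C : Formula} : Deriv Ax (((A.cond C).and (B.cond C)).imp ((A.or B).cond C))

/-- Derivability in the basic preferential conditional logic PCL. -/
def PCL : Formula → Prop := Deriv ∅

/-- Forcing of a formula at a world, for raw neighbourhood data. -/
def Force {W : Type} (N : W → Set (Set W)) (val : ℕ → Set W) : Formula → W → Prop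
  | Formula.atom p, x => x ∈ val p
  | Formula.bot, _ => False
  | Formula.and A B, x => Force N val A x ∧ Force N val B x
  | Formula.or A B, x => Force N val A x ∨ Force N val B x
  | Formula.imp A B, x => Force N val A x → Force N val B x
  | Formula.cond A B, x => ∀ α ∈ N x, (∃ y ∈ α, Force N val A y) →
      ∃ β ∈ N x, β ⊆ α ∧ (∃ y ∈ β, Force N val A y) ∧
        ∀ y ∈ β, (Force N val A y → Force N val B y)

/-- A neighbourhood model. -/
structure NbhdModel where
  W : Type
  wNonempty : Nonempty W
  N : W → Set (Set W)
  val : ℕ → Set W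
  nbhdNonempty : ∀ x : W, ∀ α ∈ N x, α.Nonempty

/-- Forcing in a neighbourhood model. -/
def NbhdModel.force (M : NbhdModel) : Formula → M.W → Prop := Force M.N M.val

/-- Validity in the class of all neighbourhood models. -/
def ValidAll (F : Formula) : Prop := ∀ (M : NbhdModel) (x : M.W), M.force F x

/-- Total reflexivity. -/
def NbhdModel.TotallyReflexive (M : NbhdModel) : Prop :=
  ∀ x : M.W, ∃ α ∈ M.N x, x ∈ α

/-- Weak centering. -/
def NbhdModel.WeaklyCentered (M : NbhdModel) : Prop :=
  ∀ x : M.W, ∀ α ∈ M.N x, x ∈ α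

/-- Centering. -/
def NbhdModel.Centered (M : NbhdModel) : Prop :=
  (∀ x : M.W, ∀ α ∈ M.N x, x ∈ α) ∧ ∀ x : M.W, {x} ∈ M.N x

/-- Uniformity. -/
def NbhdModel.Uniform (M : NbhdModel) : Prop :=
  ∀ x y : M.W, (∃ α ∈ M.N x, y ∈ α) → ⋃₀ M.N x = ⋃₀ M.N y

/-- Absoluteness. -/
def NbhdModel.Absolute (M : NbhdModel) : Prop :=
  ∀ x y : M.W, ∀ α ∈ M.N x, y ∈ α → M.N x = M.N y

/-- Conjunction of a list of formulas. -/
def conj : List Formula → Formula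
  | [] => Formula.top
  | A :: l => A.and (conj l)

/-- A set of formulas is inconsistent if some nonempty finite list of its members
has a PCL-provably contradictory conjunction. -/
def Inconsistent (S : Set Formula) : Prop :=
  ∃ L : List Formula, L ≠ [] ∧ (∀ B ∈ L, B ∈ S) ∧ PCL ((conj L).imp Formula.bot)

def Consistent (S : Set Formula) : Prop := ¬ Inconsistent S

/-- Maximal consistent set. -/
def MaxConsistent (S : Set Formula) : Prop :=
  Consistent S ∧ ∀ A ∉ S, Inconsistent (insert A S)

/-- Set of conditional consequences X^B = {C : B > C ∈ X}. -/
def condCons (X : Set Formula) (B : Formula) : Set Formula := {C | B.cond C ∈ X}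

/-- A ≤_X B iff (A ∨ B) > A ∈ X. -/
def cleq (X : Set Formula) (A B : Formula) : Prop := (A.or B).cond A ∈ X

/-- Worlds of the canonical model: pairs (X, A) with X maximal consistent, A ∈ X. -/
def CanonWorld : Type :=
  {p : Set Formula × Formula // MaxConsistent p.1 ∧ p.2 ∈ p.1}

/-- Canonical neighbourhood α^X_{(Y,B)}. -/
def sphere (X : Set Formula) (Y : CanonWorld) : Set CanonWorld :=
  {Z | condCons X Z.val.2 ⊆ Z.val.1 ∧ cleq X Z.val.2 Y.val.2 ∧ Y.val.2 ∉ Z.val.1}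
    ∪ {Y}

/-- Canonical neighbourhood function 𝒩(X,A). -/
def canonN (x : CanonWorld) : Set (Set CanonWorld) :=
  {α | ∃ Y : CanonWorld, condCons x.val.1 Y.val.2 ⊆ Y.val.1 ∧ α = sphere x.val.1 Y}

/-- Canonical valuation. -/
def canonVal (p : ℕ) : Set CanonWorld := {w | Formula.atom p ∈ w.val.1}

/-- Axiom (N). -/
def axN : Formula := (Formula.top.cond Formula.bot).neg
/-- Axiom schema (T). -/
def axT : Set Formula := {F | ∃ A : Formula, F = A.imp (A.cond Formula.bot).neg}
/-- Axiom schema (W). -/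
def axW : Set Formula := {F | ∃ A B : Formula, F = (A.cond B).imp (A.imp B)}
/-- Axiom schema (C). -/
def axC : Set Formula := {F | ∃ A B : Formula, F = (A.and B).imp (A.cond B)}
/-- Axiom schema (U1). -/
def axU1 : Set Formula :=
  {F | ∃ A : Formula,
    F = (A.neg.cond Formula.bot).imp ((A.neg.cond Formula.bot).neg.cond Formula.bot)}
/-- Axiom schema (U2). -/
def axU2 : Set Formula :=
  {F | ∃ A : Formula,
    F = (A.cond Formula.bot).neg.imp ((A.cond Formula.bot).cond Formula.bot)}

theorem beval_conj (v : ℕ → Bool) (w : Formula → Formula → Bool) (L : List Formula) :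
    beval v w (conj L) = true ↔ ∀ B ∈ L, beval v w B = true := by
  induction L with
  | nil => simp [conj, Formula.top, beval]
  | cons A l ih => simp [conj, beval, ih]

/-- Closure of maximal consistent sets under derivable consequence. -/
theorem mcs_closed {X : Set Formula} (hX : MaxConsistent X) {L : List Formula} (hL : L ≠ [])
    (hLX : ∀ B ∈ L, B ∈ X) {B : Formula} (hB : PCL ((conj L).imp B)) : B ∈ X := by
  classical
  by_contra hBX
  obtain ⟨M, _, hMX, hM⟩ := hX.2 B hBX
  apply hX.1
  refine ⟨L ++ M.filter (fun F => F ≠ B), by simp [hL], ?_, ?_⟩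
  · intro F hF
    rcases List.mem_append.1 hF with h | h
    · exact hLX F h
    · rw [List.mem_filter] at h
      rcases hMX F h.1 with hk | hk
      · simp [hk] at h
      · exact hk
  · refine Deriv.mp (Deriv.mp (Deriv.taut ?_) hB) hM
    intro v w
    have key : beval v w (conj (L ++ M.filter (fun F => F ≠ B))) = true →
        beval v w (conj L) = true ∧ (beval v w B = true → beval v w (conj M) = true) := by
      simp only [beval_conj]
      intro h
      refine ⟨fun F hF => h F (by simp [hF]), fun hb F hF => ?_⟩
      by_cases e : F = B
      · rw [e]; exact hb
      · exact h F (by simp [hF, e])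
    simp only [beval]
    revert key
    cases beval v w (conj (L ++ M.filter (fun F => F ≠ B))) <;> cases beval v w (conj L) <;>
      cases beval v w B <;> cases beval v w (conj M) <;> simp

theorem mcs_one {X : Set Formula} (hX : MaxConsistent X) {A B : Formula} (hA : A ∈ X)
    (h : PCL (A.imp B)) : B ∈ X := by
  refine mcs_closed hX (L := [A]) (by simp) (by simpa using hA) (Deriv.mp (Deriv.taut ?_) h)
  intro v w
  simp only [beval, conj, Formula.top]
  cases beval v w A <;> cases beval v w B <;> rfl

theorem mcs_two {X : Set Formula} (hX : MaxConsistent X) {A G B : Formula} (hA : A ∈ X)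
    (hG : G ∈ X) (h : PCL ((A.and G).imp B)) : B ∈ X := by
  refine mcs_closed hX (L := [A, G]) (by simp) (by simp [hA, hG]) (Deriv.mp (Deriv.taut ?_) h)
  intro v w
  simp only [beval, conj, Formula.top]
  cases beval v w A <;> cases beval v w G <;> cases beval v w B <;> rfl

theorem mcs_thm {X : Set Formula} (hX : MaxConsistent X) {A B : Formula} (hA : A ∈ X)
    (h : PCL B) : B ∈ X := by
  refine mcs_one hX hA (Deriv.mp (Deriv.taut ?_) h)
  intro v w
  simp only [beval]
  cases beval v w A <;> cases beval v w B <;> rfl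

theorem mcs_rck {X : Set Formula} (hX : MaxConsistent X) {A B C : Formula} (hA : A.cond B ∈ X)
    (h : Tautology (B.imp C)) : A.cond C ∈ X :=
  mcs_one hX hA (Deriv.rck (Deriv.taut h))

theorem mcs_rcea {X : Set Formula} (hX : MaxConsistent X) {A B C : Formula} (hA : A.cond C ∈ X)
    (h : Tautology (A.biimp B)) : B.cond C ∈ X := by
  refine mcs_one hX hA (Deriv.mp (Deriv.taut ?_) (Deriv.rcea (C := C) (Deriv.taut h)))
  intro v w
  simp only [beval, Formula.biimp]
  cases w A C <;> cases w B C <;> rfl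

theorem le_chain {X : Set Formula} (hX : MaxConsistent X) {B C D : Formula}
    (h1 : cleq X C D) (h2 : cleq X D B) :
    cleq X C B ∧ C.cond (B.imp D) ∈ X := by
  unfold cleq at *
  have hid : ∀ A : Formula, A.cond A ∈ X := fun A => mcs_thm hX h1 Deriv.id
  have hor : ∀ {P Q R : Formula}, P.cond R ∈ X → Q.cond R ∈ X → (P.or Q).cond R ∈ X :=
    fun hp hq => mcs_two hX hp hq Deriv.or
  have hcm : ∀ {P Q R : Formula}, P.cond Q ∈ X → P.cond R ∈ X → (P.and Q).cond R ∈ X :=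
    fun hp hq => mcs_two hX hp hq Deriv.cm
  have hand : ∀ {P Q R : Formula}, P.cond Q ∈ X → P.cond R ∈ X → P.cond (Q.and R) ∈ X :=
    fun hp hq => mcs_two hX hp hq Deriv.rAnd
  -- E := C ∨ (D ∨ B)
  have e1 : (C.or (D.or B)).cond (C.or D) ∈ X := by
    apply hor
    · refine mcs_rck hX (hid C) ?_
      intro v w; simp only [beval]
      cases beval v w C <;> cases beval v w D <;> rfl
    · refine mcs_rck hX h2 ?_
      intro v w; simp only [beval]
      cases beval v w C <;> cases beval v w D <;> rfl
  have e2 : (C.or (D.or B)).cond ((C.or D).imp C) ∈ X := by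
    have a : (C.or D).cond ((C.or D).imp C) ∈ X := by
      refine mcs_rck hX h1 ?_
      intro v w; simp only [beval]
      cases beval v w C <;> cases beval v w D <;> rfl
    have b : (B.and (C.or D).neg).cond ((C.or D).imp C) ∈ X := by
      refine mcs_rck hX (hid _) ?_
      intro v w; simp only [beval, Formula.neg]
      cases beval v w C <;> cases beval v w D <;> cases beval v w B <;> rfl
    refine mcs_rcea hX (hor a b) ?_
    intro v w; simp only [beval, Formula.neg, Formula.biimp]
    cases beval v w C <;> cases beval v w D <;> cases beval v w B <;> rfl
  have e3 : (C.or (D.or B)).cond C ∈ X := by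
    refine mcs_rck hX (hand e1 e2) ?_
    intro v w; simp only [beval]
    cases beval v w C <;> cases beval v w D <;> rfl
  constructor
  · have a : (C.or (D.or B)).cond (C.or B) ∈ X := by
      refine mcs_rck hX e3 ?_
      intro v w; simp only [beval]
      cases beval v w C <;> cases beval v w B <;> rfl
    refine mcs_rcea hX (hcm a e3) ?_
    intro v w; simp only [beval, Formula.biimp]
    cases beval v w C <;> cases beval v w D <;> cases beval v w B <;> rfl
  · have a : (D.or B).cond (B.imp D) ∈ X := by
      refine mcs_rck hX h2 ?_
      intro v w; simp only [beval]
      cases beval v w D <;> cases beval v w B <;> rfl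
    have b : (C.and (D.or B).neg).cond (B.imp D) ∈ X := by
      refine mcs_rck hX (hid _) ?_
      intro v w; simp only [beval, Formula.neg]
      cases beval v w C <;> cases beval v w D <;> cases beval v w B <;> rfl
    have c : (C.or (D.or B)).cond (B.imp D) ∈ X := by
      refine mcs_rcea hX (hor a b) ?_
      intro v w; simp only [beval, Formula.neg, Formula.biimp]
      cases beval v w C <;> cases beval v w D <;> cases beval v w B <;> rfl
    refine mcs_rcea hX (hcm e3 c) ?_
    intro v w; simp only [beval, Formula.biimp]
    cases beval v w C <;> cases beval v w D <;> cases beval v w B <;> rfl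

/-- Nesting of canonical neighbourhoods. -/
theorem sphere_nesting (XA YB UD : CanonWorld)
    (h1 : sphere XA.val.1 YB ∈ canonN XA)
    (h2 : UD ∈ sphere XA.val.1 YB) :
    sphere XA.val.1 UD ⊆ sphere XA.val.1 YB := by
  intro Z hZ
  rcases h2 with ⟨_, hDB, _⟩ | h2
  · rcases hZ with ⟨hCZ, hCD, hDZ⟩ | hZ
    · obtain ⟨hCB, hc⟩ := le_chain XA.property.1 hCD hDB
      refine Or.inl ⟨hCZ, hCB, fun hBZ => hDZ ?_⟩
      refine mcs_two Z.property.1 hBZ (hCZ hc) (Deriv.taut ?_)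
      intro v w; simp only [beval]
      cases beval v w YB.val.2 <;> cases beval v w UD.val.2 <;> rfl
    · rw [Set.mem_singleton_iff] at hZ
      subst hZ
      exact Or.inl ⟨by assumption, hDB, by assumption⟩
  · rw [Set.mem_singleton_iff] at h2
    subst h2
    exact hZ
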